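/- Under Assumption 1, for every s-t cut C of G′, the splitting V_D = {v ∈ V ∖ P : v ∈ C} ∪ {p ∈ P : p′ ∈ C} satisfies T(V_D) ≤ T_{G′}(C). Consequently the minimum training delay over all splittings is at most the minimum s-t cut value of G′. (Splitting-recovery half of the proof of Theorem 1.) -/

import Mathlib

open Finset

attribute [local instance] Classical.propDecidable

/-- Split-learning delay model: layers `V`, directed edges `E` (child consumes
parent's output), iteration count `N`, transmission rates `RD` (device→server)
and `RS` (server→device), per-layer device/server computation delays `xiD`/`xiS`,
parameter size `k`, and smashed-data size `a`. -/
structure SLModel (V : Type) where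
  E : Finset (V × V)
  N : ℝ
  RD : ℝ
  RS : ℝ
  xiD : V → ℝ
  xiS : V → ℝ
  k : V → ℝ
  a : V → ℝ

/-- The standing hypotheses: positive `N`, `RD`, `RS`, nonnegative per-layer
parameters, and `E` is acyclic (admits a topological ordering). -/
def SLModel.Valid {V : Type} (M : SLModel V) : Prop :=
  0 < M.N ∧ 0 < M.RD ∧ 0 < M.RS ∧ (∀ v, 0 ≤ M.xiD v) ∧ (∀ v, 0 ≤ M.xiS v) ∧
    (∀ v, 0 ≤ M.k v) ∧ (∀ v, 0 ≤ M.a v) ∧ ∃ f : V → ℕ, ∀ e ∈ M.E, f e.1 < f e.2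

/-- Boundary set `V_c` of a splitting `VD`: device layers with a child on the server. -/
noncomputable def SLModel.boundary {V : Type} (M : SLModel V) (VD : Finset V) : Finset V :=
  VD.filter (fun v => ∃ u, (v, u) ∈ M.E ∧ u ∉ VD)

/-- Training delay `T(V_D)` of a splitting. -/
noncomputable def SLModel.T {V : Type} [Fintype V] (M : SLModel V) (VD : Finset V) : ℝ :=
  M.N * ((∑ v ∈ VD, M.xiD v) + (∑ v ∈ M.boundary VD, M.a v / M.RD)
      + (∑ v ∈ Finset.univ \ VD, M.xiS v) + (∑ v ∈ M.boundary VD, M.a v / M.RS))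
    + (∑ v ∈ VD, M.k v / M.RD) + (∑ v ∈ VD, M.k v / M.RS)

/-- Number of children of `v` under `E`. -/
noncomputable def childCount {V : Type} (M : SLModel V) (v : V) : ℕ :=
  (M.E.filter (fun e => e.1 = v)).card

/-- `P`: the set of parent vertices with at least two children. -/
noncomputable def Pset {V : Type} [Fintype V] (M : SLModel V) : Finset V :=
  Finset.univ.filter (fun p => 2 ≤ childCount M p)

/-- Nodes of the restructured DAG `G'`: layer `v`, auxiliary vertex `p'`
(meaningful for `p ∈ P`), source `D`, sink `S`. -/
def layerN {V : Type} (v : V) : V ⊕ V ⊕ Bool := Sum.inl v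

def auxN {V : Type} (p : V) : V ⊕ V ⊕ Bool := Sum.inr (Sum.inl p)

def srcN {V : Type} : V ⊕ V ⊕ Bool := Sum.inr (Sum.inr false)

def snkN {V : Type} : V ⊕ V ⊕ Bool := Sum.inr (Sum.inr true)

/-- Weighted edges of the restructured DAG `G'`: for each `p ∈ P` all edges of
`G` into `p` are redirected into `p'`, the edge `(p, S)` becomes `(p', S)`, and a
new edge `(p', p)` carries `p`'s propagation weight; all other edges of `G` are
kept unchanged.  `wG' M x y` is the weight of the edge `(x, y)` (0 if absent). -/
noncomputable def wG' {V : Type} [Fintype V] (M : SLModel V) :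
    (V ⊕ V ⊕ Bool) → (V ⊕ V ⊕ Bool) → ℝ
  | Sum.inl u, Sum.inl v =>
      if (u, v) ∈ M.E ∧ v ∉ Pset M then M.N * (M.a u / M.RD + M.a u / M.RS) else 0
  | Sum.inl u, Sum.inr (Sum.inl v) =>
      if (u, v) ∈ M.E ∧ v ∈ Pset M then M.N * (M.a u / M.RD + M.a u / M.RS) else 0
  | Sum.inl v, Sum.inr (Sum.inr b) =>
      if b = true ∧ v ∉ Pset M then M.N * M.xiD v + M.k v / M.RD + M.k v / M.RS else 0
  | Sum.inr (Sum.inl p), Sum.inl q =>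
      if p = q ∧ p ∈ Pset M then M.N * (M.a p / M.RD + M.a p / M.RS) else 0
  | Sum.inr (Sum.inl p), Sum.inr (Sum.inr b) =>
      if b = true ∧ p ∈ Pset M then M.N * M.xiD p + M.k p / M.RD + M.k p / M.RS else 0
  | Sum.inr (Sum.inr b), Sum.inl v =>
      if b = false ∧ v ∉ Pset M then M.N * M.xiS v else 0
  | Sum.inr (Sum.inr b), Sum.inr (Sum.inl p) =>
      if b = false ∧ p ∈ Pset M then M.N * M.xiS p else 0
  | _, _ => 0

/-- An s-t cut of `G'`: a vertex set containing `D` and not `S`. -/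
def IsCutG' {V : Type} (C : Finset (V ⊕ V ⊕ Bool)) : Prop :=
  srcN ∈ C ∧ snkN ∉ C

/-- Value `T_{G'}(C)` of a cut: total weight of edges from inside `C` to outside `C`. -/
noncomputable def cutValG' {V : Type} [Fintype V] (M : SLModel V)
    (C : Finset (V ⊕ V ⊕ Bool)) : ℝ :=
  ∑ x : V ⊕ V ⊕ Bool, ∑ y : V ⊕ V ⊕ Bool, if x ∈ C ∧ y ∉ C then wG' M x y else 0

/-- Splitting induced by a cut `C` of `G'`:
`V_D = {v ∈ V∖P : v ∈ C} ∪ {p ∈ P : p' ∈ C}`. -/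
noncomputable def splitOfCut {V : Type} [Fintype V] (M : SLModel V)
    (C : Finset (V ⊕ V ⊕ Bool)) : Finset V :=
  (Finset.univ \ Pset M).filter (fun v => layerN v ∈ C)
    ∪ (Pset M).filter (fun p => auxN p ∈ C)

theorem mem_splitOfCut {V : Type} [Fintype V] (M : SLModel V) (C : Finset (V ⊕ V ⊕ Bool))
    (v : V) :
    v ∈ splitOfCut M C ↔ (v ∉ Pset M ∧ layerN v ∈ C) ∨ (v ∈ Pset M ∧ auxN v ∈ C) := by
  simp [splitOfCut]

/-- The propagation weight `N (a(v)/R_D + a(v)/R_S)` of the edges leaving `v`. -/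
noncomputable def SLModel.propWeight {V : Type} (M : SLModel V) (v : V) : ℝ :=
  M.N * (M.a v / M.RD + M.a v / M.RS)

/-- The device-execution weight of `v`. -/
noncomputable def SLModel.deviceWeight {V : Type} (M : SLModel V) (v : V) : ℝ :=
  M.N * M.xiD v + M.k v / M.RD + M.k v / M.RS

theorem SLModel.T_eq_sum {V : Type} [Fintype V] (M : SLModel V) (VD : Finset V) :
    M.T VD = ∑ v, ((if v ∈ VD then M.deviceWeight v else M.N * M.xiS v)
      + if v ∈ M.boundary VD then M.propWeight v else 0) := by
  have hS : ∑ v, (if v ∈ VD then M.deviceWeight v else M.N * M.xiS v)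
      = ∑ v ∈ VD, M.deviceWeight v + ∑ v ∈ Finset.univ \ VD, M.N * M.xiS v := by
    rw [Finset.sum_ite]
    congr 2 <;> ext v <;> simp
  rw [Finset.sum_add_distrib, hS, Finset.sum_ite_mem, Finset.univ_inter]
  simp only [SLModel.T, SLModel.deviceWeight, SLModel.propWeight, Finset.sum_add_distrib,
    ← Finset.mul_sum]
  ring

theorem wG'_nonneg {V : Type} [Fintype V] {M : SLModel V} (hM : M.Valid)
    (x y : V ⊕ V ⊕ Bool) : 0 ≤ wG' M x y := by
  obtain ⟨hN, hRD, hRS, hD, hS, hk, ha, -⟩ := hM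
  rcases x with u | u | u <;> rcases y with v | v | v <;> simp only [wG'] <;>
    first
    | exact le_rfl
    | (split_ifs
       · have := hD u; have := hS u; have := hk u; have := ha u
         positivity
       · exact le_rfl)
    | (split_ifs
       · have := hS v
         positivity
       · exact le_rfl)

/-- The weight cut by `C` on the edge `(x, y)`. -/
noncomputable def cutTerm {V : Type} [Fintype V] (M : SLModel V) (C : Finset (V ⊕ V ⊕ Bool))
    (x y : V ⊕ V ⊕ Bool) : ℝ :=
  if x ∈ C ∧ y ∉ C then wG' M x y else 0

theorem cutTerm_nonneg {V : Type} [Fintype V] {M : SLModel V} (hM : M.Valid)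
    (C : Finset (V ⊕ V ⊕ Bool)) (x y : V ⊕ V ⊕ Bool) : 0 ≤ cutTerm M C x y := by
  unfold cutTerm
  split_ifs
  · exact wG'_nonneg hM x y
  · exact le_rfl

/-- A cut value, grouped by layers: propagation edges leaving `v`, the edge `(v', v)`,
and the execution edges of `v`. -/
theorem sum_cutTerm_le_cutValG' {V : Type} [Fintype V] {M : SLModel V} (hM : M.Valid)
    (C : Finset (V ⊕ V ⊕ Bool)) :
    ∑ v, ((∑ u, cutTerm M C (layerN v) (layerN u) + ∑ u, cutTerm M C (layerN v) (auxN u))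
      + cutTerm M C (auxN v) (layerN v)
      + (cutTerm M C (layerN v) snkN + cutTerm M C (auxN v) snkN)
      + (cutTerm M C srcN (layerN v) + cutTerm M C srcN (auxN v))) ≤ cutValG' M C := by
  have h0 := cutTerm_nonneg hM C
  have hdiag : ∑ v, cutTerm M C (auxN v) (layerN v)
      ≤ ∑ v, ∑ u, cutTerm M C (auxN v) (layerN u) :=
    Finset.sum_le_sum fun v _ =>
      Finset.single_le_sum (f := fun u => cutTerm M C (auxN v) (layerN u))
        (fun u _ => h0 _ _) (Finset.mem_univ v)
  have haux : 0 ≤ ∑ v, ∑ u, cutTerm M C (auxN v) (auxN u) :=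
    Finset.sum_nonneg fun v _ => Finset.sum_nonneg fun u _ => h0 _ _
  have hlsrc : 0 ≤ ∑ v, cutTerm M C (layerN v) srcN := Finset.sum_nonneg fun v _ => h0 _ _
  have hasrc : 0 ≤ ∑ v, cutTerm M C (auxN v) srcN := Finset.sum_nonneg fun v _ => h0 _ _
  have hsnkl : 0 ≤ ∑ v, cutTerm M C snkN (layerN v) := Finset.sum_nonneg fun v _ => h0 _ _
  have hsnka : 0 ≤ ∑ v, cutTerm M C snkN (auxN v) := Finset.sum_nonneg fun v _ => h0 _ _
  have hval : cutValG' M C = ∑ x, ∑ y, cutTerm M C x y := rfl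
  have h1 := h0 srcN srcN
  have h2 := h0 srcN snkN
  have h3 := h0 snkN srcN
  have h4 := h0 snkN snkN
  rw [hval]
  simp only [Fintype.sum_sum_type, Fintype.sum_bool, Finset.sum_add_distrib]
  simp only [layerN, auxN, srcN, snkN] at *
  linarith

/-- A boundary layer of the recovered splitting has its propagation weight cut, either on an
edge to a child or on its auxiliary edge. -/
theorem propWeight_le_of_mem_boundary {V : Type} [Fintype V] {M : SLModel V} (hM : M.Valid)
    (C : Finset (V ⊕ V ⊕ Bool)) {v : V} (hv : v ∈ M.boundary (splitOfCut M C)) :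
    M.propWeight v ≤
      (∑ u, cutTerm M C (layerN v) (layerN u) + ∑ u, cutTerm M C (layerN v) (auxN u))
        + cutTerm M C (auxN v) (layerN v) := by
  have h0 := cutTerm_nonneg hM C
  have hl : 0 ≤ ∑ u, cutTerm M C (layerN v) (layerN u) := Finset.sum_nonneg fun u _ => h0 _ _
  have ha : 0 ≤ ∑ u, cutTerm M C (layerN v) (auxN u) := Finset.sum_nonneg fun u _ => h0 _ _
  have hd := h0 (auxN v) (layerN v)
  obtain ⟨hvD, u, hE, hu⟩ := by simpa only [SLModel.boundary, Finset.mem_filter] using hv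
  rw [mem_splitOfCut] at hvD hu
  by_cases hvC : layerN v ∈ C
  · by_cases huP : u ∈ Pset M
    · have huC : auxN u ∉ C := fun h => hu (Or.inr ⟨huP, h⟩)
      have hcut : cutTerm M C (layerN v) (auxN u) = M.propWeight v := by
        rw [cutTerm, if_pos ⟨hvC, huC⟩]
        exact if_pos ⟨hE, huP⟩
      have := Finset.single_le_sum (f := fun u => cutTerm M C (layerN v) (auxN u))
        (fun u _ => h0 _ _) (Finset.mem_univ u)
      simp only [hcut] at this
      linarith
    · have huC : layerN u ∉ C := fun h => hu (Or.inl ⟨huP, h⟩)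
      have hcut : cutTerm M C (layerN v) (layerN u) = M.propWeight v := by
        rw [cutTerm, if_pos ⟨hvC, huC⟩]
        exact if_pos ⟨hE, huP⟩
      have := Finset.single_le_sum (f := fun u => cutTerm M C (layerN v) (layerN u))
        (fun u _ => h0 _ _) (Finset.mem_univ u)
      simp only [hcut] at this
      linarith
  · obtain ⟨hP, hC⟩ : v ∈ Pset M ∧ auxN v ∈ C := hvD.resolve_left fun h => hvC h.2
    have hcut : cutTerm M C (auxN v) (layerN v) = M.propWeight v := by
      rw [cutTerm, if_pos ⟨hC, hvC⟩]
      exact if_pos ⟨rfl, hP⟩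
    linarith

/-- The execution edges of a layer cut by `C` carry the execution weight of the side on which the
recovered splitting places it. -/
theorem cutTerm_execution {V : Type} [Fintype V] (M : SLModel V)
    {C : Finset (V ⊕ V ⊕ Bool)} (hC : IsCutG' C) (v : V) :
    (cutTerm M C (layerN v) snkN + cutTerm M C (auxN v) snkN)
      + (cutTerm M C srcN (layerN v) + cutTerm M C srcN (auxN v))
      = if v ∈ splitOfCut M C then M.deviceWeight v else M.N * M.xiS v := by
  obtain ⟨hsrc, hsnk⟩ := hC
  simp only [mem_splitOfCut, cutTerm, hsrc, hsnk]
  by_cases hP : v ∈ Pset M <;> by_cases hl : layerN v ∈ C <;> by_cases ha : auxN v ∈ C <;>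
    simp [hP, hl, ha] <;> simp [layerN, auxN, srcN, snkN, wG', hP, SLModel.deviceWeight]

theorem T_splitOfCut_le {V : Type} [Fintype V] {M : SLModel V} (hM : M.Valid)
    {C : Finset (V ⊕ V ⊕ Bool)} (hC : IsCutG' C) : M.T (splitOfCut M C) ≤ cutValG' M C := by
  refine le_trans ?_ (sum_cutTerm_le_cutValG' hM C)
  rw [SLModel.T_eq_sum]
  refine Finset.sum_le_sum fun v _ => ?_
  rw [← cutTerm_execution M hC v]
  have h0 := cutTerm_nonneg hM C
  split_ifs with hv
  · linarith [propWeight_le_of_mem_boundary hM C hv]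
  · have hl : 0 ≤ ∑ u, cutTerm M C (layerN v) (layerN u) := Finset.sum_nonneg fun u _ => h0 _ _
    have ha : 0 ≤ ∑ u, cutTerm M C (layerN v) (auxN u) := Finset.sum_nonneg fun u _ => h0 _ _
    linarith [h0 (auxN v) (layerN v)]

/-- **Splitting-recovery half of Theorem 1.** Under Assumption 1, for every s-t
cut `C` of `G'` the splitting `V_D = {v ∈ V∖P : v ∈ C} ∪ {p ∈ P : p' ∈ C}`
satisfies `T(V_D) ≤ T_{G'}(C)`; consequently the minimum training delay over all
splittings is at most the minimum s-t cut value of `G'`. -/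
theorem splitting_recovery {V : Type} [Fintype V] (M : SLModel V) (hM : M.Valid)
    (hAss1 : ∀ v, M.xiS v ≤ M.xiD v) :
    (∀ C : Finset (V ⊕ V ⊕ Bool), IsCutG' C → M.T (splitOfCut M C) ≤ cutValG' M C)
    ∧ sInf {x : ℝ | ∃ VD : Finset V, x = M.T VD}
        ≤ sInf {x : ℝ | ∃ C : Finset (V ⊕ V ⊕ Bool), IsCutG' C ∧ x = cutValG' M C} := by
  refine ⟨fun C hC => T_splitOfCut_le hM hC, ?_⟩
  have hsrc : IsCutG' ({srcN} : Finset (V ⊕ V ⊕ Bool)) := by simp [IsCutG', srcN, snkN]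
  refine le_csInf ⟨cutValG' M {srcN}, {srcN}, hsrc, rfl⟩ ?_
  rintro _ ⟨C, hC, rfl⟩
  have hbdd : BddBelow {x : ℝ | ∃ VD : Finset V, x = M.T VD} := by
    refine ((Set.finite_range M.T).subset ?_).bddBelow
    rintro _ ⟨VD, rfl⟩
    exact Set.mem_range_self VD
  exact (csInf_le hbdd ⟨splitOfCut M C, rfl⟩).trans (T_splitOfCut_le hM hC)
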